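/- Let L be a linear map on M_n(ℂ) with L(1) = 0 and L(x*) = L(x)* for all x. Then L is completely dissipative if and only if L is conditionally negative. That is: [for every k ≥ 1 and every X ∈ M_k(M_n(ℂ)) (a k×k block matrix with n×n entries), writing L_k for the blockwise application of L, the matrix X* L_k(X) + L_k(X)* X − L_k(X* X) is positive semidefinite] holds if and only if [for all m and all x_1, …, x_m, y_1, …, y_m ∈ M_n(ℂ) with Σ_{j=1}^m x_j y_j = 0, the matrix −Σ_{j,k=1}^m y_j* L(x_j* x_k) y_k is positive semidefinite]. -/

import Mathlib

open Matrix
open scoped ComplexOrder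

noncomputable section

/-- `Mat n` is the algebra of complex `n × n` matrices. -/
abbrev Mat (n : ℕ) : Type := Matrix (Fin n) (Fin n) ℂ

/-- Blockwise application of a linear map on `Mat n` to a `k × k` block matrix with
`n × n` blocks (i.e. the map `L ⊗ id_k`). -/
def blockMap (n k : ℕ) (L : Mat n →ₗ[ℂ] Mat n)
    (X : Matrix (Fin k × Fin n) (Fin k × Fin n) ℂ) :
    Matrix (Fin k × Fin n) (Fin k × Fin n) ℂ :=
  Matrix.of fun p q => L (Matrix.of fun i j => X (p.1, i) (q.1, j)) p.2 q.2

/-- `L` is completely dissipative: for every `k ≥ 1` and every `k × k` block matrix `X`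
with `n × n` blocks, writing `L_k` for the blockwise application of `L`,
`X* L_k(X) + L_k(X)* X − L_k(X* X)` is positive semidefinite. -/
def CompletelyDissipative (n : ℕ) (L : Mat n →ₗ[ℂ] Mat n) : Prop :=
  ∀ k : ℕ, 1 ≤ k → ∀ X : Matrix (Fin k × Fin n) (Fin k × Fin n) ℂ,
    (Xᴴ * blockMap n k L X + (blockMap n k L X)ᴴ * X - blockMap n k L (Xᴴ * X)).PosSemidef

/-- `L` is conditionally negative: for all `x_1, …, x_m, y_1, …, y_m` with
`Σ_j x_j y_j = 0`, the matrix `− Σ_{j,k} y_j* L(x_j* x_k) y_k` is positive semidefinite. -/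
def CondNeg (n : ℕ) (L : Mat n →ₗ[ℂ] Mat n) : Prop :=
  ∀ (m : ℕ) (x y : Fin m → Mat n), (∑ j, x j * y j) = 0 →
    (-(∑ j, ∑ k, (y j)ᴴ * L ((x j)ᴴ * x k) * y k)).PosSemidef

def DD {n : ℕ} (L : Mat n →ₗ[ℂ] Mat n) (a b : Mat n) : Mat n :=
  aᴴ * L b + (L a)ᴴ * b - L (aᴴ * b)

def blk {n k : ℕ} (M : Fin k → Fin k → Mat n) : Matrix (Fin k × Fin n) (Fin k × Fin n) ℂ :=
  Matrix.of fun p q => M p.1 q.1 p.2 q.2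

def colm {n k : ℕ} (y : Fin k → Mat n) : Matrix (Fin k × Fin n) (Fin n) ℂ :=
  Matrix.of fun p j => y p.1 p.2 j

lemma compress {n k : ℕ} (M : Fin k → Fin k → Mat n) (y : Fin k → Mat n) :
    (colm y)ᴴ * blk M * colm y = ∑ j, ∑ l, (y j)ᴴ * M j l * y l := by
  ext a b
  simp only [Matrix.mul_apply, Matrix.sum_apply, Fintype.sum_prod_type, colm, blk,
    Matrix.of_apply, Matrix.conjTranspose_apply, Finset.sum_mul]
  rw [Finset.sum_comm_cycle]

lemma dissip_eq {n k : ℕ} (L : Mat n →ₗ[ℂ] Mat n)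
    (X : Matrix (Fin k × Fin n) (Fin k × Fin n) ℂ) :
    Xᴴ * blockMap n k L X + (blockMap n k L X)ᴴ * X - blockMap n k L (Xᴴ * X)
      = ∑ r, blk fun p q => DD L (Matrix.of fun i j => X (r, i) (p, j))
          (Matrix.of fun i j => X (r, i) (q, j)) := by
  have h : ∀ p q : Fin k, (Matrix.of fun i j => (Xᴴ * X) (p, i) (q, j) : Mat n)
      = ∑ r, (Matrix.of fun i j => X (r, i) (p, j) : Mat n)ᴴ *
          (Matrix.of fun i j => X (r, i) (q, j) : Mat n) := by
    intro p q
    ext i j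
    simp [Matrix.mul_apply, Matrix.sum_apply, Fintype.sum_prod_type]
  ext ⟨p, i⟩ ⟨q, j⟩
  simp only [blockMap, Matrix.sub_apply, Matrix.add_apply, Matrix.of_apply, h, map_sum,
    Matrix.sum_apply, blk, DD, Finset.sum_sub_distrib, Finset.sum_add_distrib]
  simp [Matrix.mul_apply, Fintype.sum_prod_type]

lemma DD_herm {n : ℕ} (L : Mat n →ₗ[ℂ] Mat n) (hLstar : ∀ x : Mat n, L xᴴ = (L x)ᴴ)
    (a b : Mat n) : (DD L a b)ᴴ = DD L b a := by
  simp only [DD, conjTranspose_sub, conjTranspose_add, conjTranspose_mul, ← hLstar,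
    conjTranspose_conjTranspose]
  abel

lemma row_psd {n k : ℕ} (L : Mat n →ₗ[ℂ] Mat n)
    (hL1 : L 1 = 0) (hLstar : ∀ x : Mat n, L xᴴ = (L x)ᴴ) (h : CondNeg n L)
    (x : Fin k → Mat n) : (blk fun p q => DD L (x p) (x q)).PosSemidef := by
  apply Matrix.PosSemidef.of_dotProduct_mulVec_nonneg
  · ext ⟨p, i⟩ ⟨q, j⟩
    have := congrFun (congrFun (DD_herm L hLstar (x q) (x p)) i) j
    simpa [blk] using this
  · intro v
    rcases Nat.eq_zero_or_pos n with rfl | hn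
    · simp [dotProduct, Fintype.sum_prod_type]
    let y : Fin k → Mat n := fun q => Matrix.of fun i _ => v (q, i)
    let s : Mat n := ∑ q, x q * y q
    have h1 := h (k+1) (Fin.cons 1 x) (Fin.cons (-s) y) (by
      simp [Fin.sum_univ_succ, s])
    have h2 := h1.diag_nonneg (i := ⟨0, hn⟩)
    have e : -(∑ j : Fin (k+1), ∑ l : Fin (k+1), ((Fin.cons (-s) y : Fin (k+1) → Mat n) j)ᴴ *
        L (((Fin.cons 1 x : Fin (k+1) → Mat n) j)ᴴ * (Fin.cons 1 x : Fin (k+1) → Mat n) l) *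
        (Fin.cons (-s) y : Fin (k+1) → Mat n) l) = ∑ j, ∑ l, (y j)ᴴ * DD L (x j) (x l) * y l := by
      have e1 : ∑ j, ∑ l, (y j)ᴴ * ((x j)ᴴ * L (x l)) * y l = ∑ l, sᴴ * L (x l) * y l := by
        rw [Finset.sum_comm]
        simp only [s, conjTranspose_sum, conjTranspose_mul, Finset.sum_mul, Matrix.mul_assoc]
      have e2 : ∑ j, ∑ l, (y j)ᴴ * ((L (x j))ᴴ * x l) * y l = ∑ j, (y j)ᴴ * (L (x j))ᴴ * s := by
        simp only [s, Finset.mul_sum, Matrix.mul_assoc]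
      simp only [DD, Matrix.mul_sub, Matrix.mul_add, Matrix.sub_mul, Matrix.add_mul,
        Finset.sum_sub_distrib, Finset.sum_add_distrib, e1, e2]
      simp [Fin.sum_univ_succ, hL1, hLstar, Finset.sum_add_distrib]
      abel
    rw [e, ← compress] at h2
    convert h2 using 1
    simp only [Matrix.mul_assoc]
    simp [Matrix.mul_apply, dotProduct, mulVec, colm, y]

/-- For a linear map `L` on `M_n(ℂ)` with `L(1) = 0` and `L(x*) = L(x)*`, complete
dissipativity is equivalent to conditional negativity. -/
theorem completelyDissipative_iff_condNeg {n : ℕ} (L : Mat n →ₗ[ℂ] Mat n)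
    (hL1 : L 1 = 0) (hLstar : ∀ x : Mat n, L xᴴ = (L x)ᴴ) :
    CompletelyDissipative n L ↔ CondNeg n L := by
  constructor
  · intro h m x y hxy
    rcases Nat.eq_zero_or_pos m with rfl | hm
    · simpa using Matrix.PosSemidef.zero
    let r0 : Fin m := ⟨0, hm⟩
    have h1 := h m hm (Matrix.of fun p q => if p.1 = r0 then x q.1 p.2 q.2 else 0)
    rw [dissip_eq, Finset.sum_eq_single r0] at h1
    · have h2 := h1.conjTranspose_mul_mul_same (colm y)
      rw [compress] at h2
      have ex : ∀ p, (Matrix.of fun i j => x p i j) = x p := fun p => rfl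
      simp only [Matrix.of_apply, if_true, ex] at h2
      convert h2 using 1
      have e1 : ∑ j, ∑ l, (y j)ᴴ * ((x j)ᴴ * L (x l)) * y l = 0 := by
        rw [Finset.sum_comm]
        have : ∀ l, ∑ j, (y j)ᴴ * ((x j)ᴴ * L (x l)) * y l
            = (∑ j, x j * y j)ᴴ * (L (x l) * y l) := by
          intro l
          simp only [conjTranspose_sum, conjTranspose_mul, Finset.sum_mul, Matrix.mul_assoc]
        simp [this, hxy]
      have e2 : ∑ j, ∑ l, (y j)ᴴ * ((L (x j))ᴴ * x l) * y l = 0 := by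
        have : ∀ j, ∑ l, (y j)ᴴ * ((L (x j))ᴴ * x l) * y l
            = (y j)ᴴ * (L (x j))ᴴ * (∑ l, x l * y l) := by
          intro j
          simp only [Finset.mul_sum, Matrix.mul_assoc]
        simp [this, hxy]
      simp only [DD, Matrix.mul_sub, Matrix.mul_add, Matrix.sub_mul, Matrix.add_mul,
        Finset.sum_sub_distrib, Finset.sum_add_distrib, e1, e2]
      simp
    · intro r _ hr
      have ez : (Matrix.of fun _ _ => 0 : Mat n) = 0 := rfl
      ext ⟨p, i⟩ ⟨q, j⟩
      simp [blk, DD, hr, ez]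
    · simp
  · intro h k _ X
    rw [dissip_eq]
    exact Matrix.posSemidef_sum _ fun r _ => row_psd L hL1 hLstar h _
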